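/- For a pure state |ψ⟩^{ABCR} = Σ_z √(p_z) |z⟩^A |z⟩^C |φ_z⟩^{BR}, where {|z⟩} is an orthonormal basis, p is a probability distribution, and |φ_z⟩ are pure states on BR, the conditional von Neumann entropies satisfy H(Z^A|R) + H(X^A|BC) = H(X^A), where Z^A denotes the classical random variable obtained by measuring A in the basis {|z⟩}, X^A the variable obtained by measuring A in the conjugate (Fourier) basis, H(Z^A|R) is the conditional entropy of the cq state Σ_z p_z |z⟩⟨z| ⊗ φ_z^R, and H(X^A|BC) that of the corresponding cq state on X and BC. For a qubit (d=2) with uniform p_z, this gives H(Z^A|R) + H(X^A|BC) = 1. -/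

import Mathlib

open scoped ComplexConjugate

/-- Von Neumann entropy (base 2) of a matrix, via the eigenvalues of its
Hermitian part (with the convention `0 log 0 = 0`, and value `0` for
non-Hermitian matrices). -/
noncomputable def vnEntropy {n : Type*} [Fintype n] [DecidableEq n]
    (ρ : Matrix n n ℂ) : ℝ :=
  if h : ρ.IsHermitian then -∑ i, h.eigenvalues i * Real.logb 2 (h.eigenvalues i) else 0

/-- Partial trace over the first tensor factor. -/
noncomputable def ptraceLeft {α β : Type*} [Fintype α]
    (M : Matrix (α × β) (α × β) ℂ) : Matrix β β ℂ :=
  Matrix.of fun i j => ∑ a, M (a, i) (a, j)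

/-- Conditional von Neumann entropy of the first system given the second:
`H(X|S) = H(XS) - H(S)`. -/
noncomputable def condEntropyFst {α β : Type*} [Fintype α] [Fintype β]
    [DecidableEq α] [DecidableEq β] (M : Matrix (α × β) (α × β) ℂ) : ℝ :=
  vnEntropy M - vnEntropy (ptraceLeft M)

open scoped Kronecker
open Matrix

lemma vnEntropy_eq_sum_roots_charpoly {n : Type*} [Fintype n] [DecidableEq n]
    {A : Matrix n n ℂ} (hA : A.IsHermitian) :
    vnEntropy A = -(A.charpoly.roots.map fun μ => μ.re * Real.logb 2 μ.re).sum := by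
  rw [vnEntropy, dif_pos hA, hA.roots_charpoly_eq_eigenvalues]
  simp [Multiset.map_map]

/-- The entropies of the two reduced states of a pure bipartite state agree. -/
lemma vnEntropy_mul_conjTranspose_comm {m n : Type*} [Fintype m] [DecidableEq m]
    [Fintype n] [DecidableEq n] (N : Matrix m n ℂ) :
    vnEntropy (N * Nᴴ) = vnEntropy (Nᵀ * Nᵀᴴ) := by
  have hT : Nᵀ * Nᵀᴴ = (Nᴴ * N)ᵀ := by
    rw [transpose_mul]; rfl
  rw [vnEntropy_eq_sum_roots_charpoly (isHermitian_mul_conjTranspose_self N),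
    vnEntropy_eq_sum_roots_charpoly (isHermitian_mul_conjTranspose_self Nᵀ), hT,
    charpoly_transpose]
  have h := congrArg (fun P : Polynomial ℂ =>
    (P.roots.map fun μ => μ.re * Real.logb 2 μ.re).sum) (charpoly_mul_comm' N Nᴴ)
  have hne : ∀ k (P : Polynomial ℂ), P.Monic → Polynomial.X ^ k * P ≠ 0 := fun k P hP =>
    mul_ne_zero (pow_ne_zero _ Polynomial.X_ne_zero) hP.ne_zero
  simp only [Polynomial.roots_mul (hne _ _ (charpoly_monic _)), Polynomial.roots_pow,
    Polynomial.roots_X, Multiset.map_add, Multiset.sum_add, Multiset.map_nsmul,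
    Multiset.sum_nsmul, Multiset.map_singleton, Multiset.sum_singleton, Complex.zero_re,
    zero_mul, smul_zero, zero_add] at h
  rw [h]

lemma vnEntropy_unitary_conj {n : Type*} [Fintype n] [DecidableEq n]
    {A U : Matrix n n ℂ} (hA : A.IsHermitian) (hU : Uᴴ * U = 1) :
    vnEntropy (U * A * Uᴴ) = vnEntropy A := by
  rw [vnEntropy_eq_sum_roots_charpoly (isHermitian_mul_mul_conjTranspose U hA),
    vnEntropy_eq_sum_roots_charpoly hA, charpoly_mul_comm, ← Matrix.mul_assoc, hU,
    Matrix.one_mul]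

lemma vnEntropy_diagonal {n : Type*} [Fintype n] [DecidableEq n] (v : n → ℝ) :
    vnEntropy (diagonal fun i => (v i : ℂ)) = -∑ i, v i * Real.logb 2 (v i) := by
  have h : (diagonal fun i => (v i : ℂ)).IsHermitian := by
    rw [isHermitian_diagonal_iff]
    intro i
    simp [IsSelfAdjoint]
  rw [vnEntropy_eq_sum_roots_charpoly h, charpoly_diagonal]
  have hr : (∏ i, (Polynomial.X - Polynomial.C (v i : ℂ))).roots =
      Finset.univ.val.map fun i => (v i : ℂ) := by
    simpa [Multiset.map_map, Function.comp_def] using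
      Polynomial.roots_multiset_prod_X_sub_C (Finset.univ.val.map fun i => (v i : ℂ))
  rw [hr]
  simp [Multiset.map_map]

/-- Entropy of the product of a maximally mixed state with a normalized Hermitian matrix. -/
lemma vnEntropy_maximallyMixed_kronecker {n : Type*} [Fintype n] [DecidableEq n]
    {d : ℕ} (hd : 0 < d) {A : Matrix n n ℂ} (hA : A.IsHermitian) (htr : A.trace = 1) :
    vnEntropy ((diagonal fun _ : Fin d => (1 / d : ℂ)) ⊗ₖ A) =
      Real.logb 2 d + vnEntropy A := by
  have hd' : (d : ℝ) ≠ 0 := by positivity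
  set U : Matrix n n ℂ := (hA.eigenvectorUnitary : Matrix n n ℂ) with hUdef
  have hU : Uᴴ * U = 1 := by
    rw [← star_eq_conjTranspose]; exact Unitary.coe_star_mul_self _
  have hspec : A = U * diagonal (fun i => (hA.eigenvalues i : ℂ)) * Uᴴ := by
    conv_lhs => rw [hA.spectral_theorem]
    rfl
  have hsum : ∑ i, hA.eigenvalues i = 1 := by
    have := hA.trace_eq_sum_eigenvalues
    rw [htr] at this
    exact Complex.ofReal_injective (by push_cast; exact this.symm)
  have hdiag : (diagonal fun a : Fin d × n => ((1 / d * hA.eigenvalues a.2 : ℝ) : ℂ)) =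
      (diagonal fun _ : Fin d => (1 / d : ℂ)) ⊗ₖ diagonal (fun i => (hA.eigenvalues i : ℂ)) := by
    rw [diagonal_kronecker_diagonal]
    push_cast
    rfl
  have hkron : (diagonal fun _ : Fin d => (1 / d : ℂ)) ⊗ₖ A =
      ((1 : Matrix (Fin d) (Fin d) ℂ) ⊗ₖ U) *
        (diagonal fun a : Fin d × n => ((1 / d * hA.eigenvalues a.2 : ℝ) : ℂ)) *
        ((1 : Matrix (Fin d) (Fin d) ℂ) ⊗ₖ U)ᴴ := by
    rw [hdiag, conjTranspose_kronecker, ← mul_kronecker_mul, ← mul_kronecker_mul, ← hspec]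
    simp
  have hUU : ((1 : Matrix (Fin d) (Fin d) ℂ) ⊗ₖ U)ᴴ * ((1 : Matrix (Fin d) (Fin d) ℂ) ⊗ₖ U) = 1 := by
    rw [conjTranspose_kronecker, ← mul_kronecker_mul, hU]
    simp
  have hterm : ∀ i, (1 / d * hA.eigenvalues i) * Real.logb 2 (1 / d * hA.eigenvalues i) =
      1 / d * (hA.eigenvalues i * Real.logb 2 (hA.eigenvalues i)
        - hA.eigenvalues i * Real.logb 2 d) := by
    intro i
    by_cases h0 : hA.eigenvalues i = 0
    · simp [h0]
    · rw [Real.logb_mul (by positivity) h0, one_div, Real.logb_inv]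
      ring
  rw [hkron, vnEntropy_unitary_conj _ hUU, vnEntropy_diagonal, Fintype.sum_prod_type]
  · simp only [hterm, ← Finset.mul_sum, Finset.sum_sub_distrib, ← Finset.sum_mul, hsum]
    rw [vnEntropy, dif_pos hA]
    simp
    field_simp
    ring
  · rw [isHermitian_diagonal_iff]
    intro i
    simp [IsSelfAdjoint]

lemma fourier_phase_mul_conj {d : ℕ} (x y z : ℕ) :
    Complex.exp (2 * (Real.pi : ℂ) * Complex.I * (x : ℂ) * (y : ℂ) / (d : ℂ)) *
      conj (Complex.exp (2 * (Real.pi : ℂ) * Complex.I * (x : ℂ) * (z : ℂ) / (d : ℂ))) =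
      (Complex.exp (2 * (Real.pi : ℂ) * Complex.I / d) ^ y /
        Complex.exp (2 * (Real.pi : ℂ) * Complex.I / d) ^ z) ^ x := by
  rw [← Complex.exp_conj, ← Complex.exp_add, ← Complex.exp_nat_mul, ← Complex.exp_nat_mul,
    ← Complex.exp_sub, ← Complex.exp_nat_mul]
  congr 1
  simp only [map_div₀, map_mul, Complex.conj_I, Complex.conj_ofReal, Complex.conj_ofNat,
    map_natCast]
  ring

lemma sum_fourier_phase_mul_conj {d : ℕ} (hd : 0 < d) (y z : Fin d) :
    ∑ x : Fin d,
      Complex.exp (2 * (Real.pi : ℂ) * Complex.I * (x.val : ℂ) * (y.val : ℂ) / (d : ℂ)) *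
      conj (Complex.exp (2 * (Real.pi : ℂ) * Complex.I * (x.val : ℂ) * (z.val : ℂ) / (d : ℂ))) =
      if y = z then (d : ℂ) else 0 := by
  have hζ := Complex.isPrimitiveRoot_exp d hd.ne'
  simp only [fourier_phase_mul_conj]
  generalize Complex.exp (2 * (Real.pi : ℂ) * Complex.I / d) = ζ at hζ
  have hζ0 : ζ ≠ 0 := hζ.ne_zero hd.ne'
  rw [Fin.sum_univ_eq_sum_range (fun x => (ζ ^ (y : ℕ) / ζ ^ (z : ℕ)) ^ x)]
  split_ifs with h
  · simp [h, hζ0]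
  · have hne : ζ ^ (y : ℕ) / ζ ^ (z : ℕ) ≠ 1 := by
      intro h1
      rw [div_eq_one_iff_eq (pow_ne_zero _ hζ0)] at h1
      exact h (Fin.ext (hζ.pow_inj y.2 z.2 h1))
    rw [geom_sum_eq hne, div_pow, ← pow_mul, ← pow_mul, mul_comm (y : ℕ), mul_comm (z : ℕ),
      pow_mul, pow_mul, hζ.pow_eq_one]
    simp

/-- Renes–Boileau certainty relation (Lemma 1).  For the pure state
`|ψ⟩^{ABCR} = Σ_z √(p_z) |z⟩^A |z⟩^C |φ_z⟩^{BR}`, measuring `A` in the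
computational ("amplitude") basis induces the cq state
`ρ_{ZR} = Σ_z p_z |z⟩⟨z| ⊗ φ_z^R`, while measuring `A` in the conjugate
(Fourier) basis induces the cq state `ρ_{X(BC)}` on `X` and `BC`; then
`H(Z^A|R) + H(X^A|BC) = H(X^A)`, and for a qubit (`d = 2`) with uniform `p`
the right-hand side equals `1`. -/
theorem certainty_relation (d : ℕ) (hd : 0 < d)
    {B R : Type*} [Fintype B] [DecidableEq B] [Fintype R] [DecidableEq R]
    (p : Fin d → ℝ) (hp0 : ∀ z, 0 ≤ p z) (hp1 : ∑ z, p z = 1)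
    (φ : Fin d → B × R → ℂ) (hφ : ∀ z, ∑ i, Complex.normSq (φ z i) = 1) :
    -- Fourier phase ω^{xz} = exp(2πi xz/d)
    let ω : Fin d → Fin d → ℂ := fun x z =>
      Complex.exp (2 * (Real.pi : ℂ) * Complex.I * (x.val : ℂ) * (z.val : ℂ) / (d : ℂ))
    -- cq state of the amplitude variable Z and the reservoir R
    let ρZR : Matrix (Fin d × R) (Fin d × R) ℂ := Matrix.of fun a b =>
      if a.1 = b.1 then (p a.1 : ℂ) * ∑ bb, φ a.1 (bb, a.2) * conj (φ a.1 (bb, b.2)) else 0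
    -- cq state of the phase variable X and the systems B, C (C carries a copy of z)
    let ρXBC : Matrix (Fin d × (B × Fin d)) (Fin d × (B × Fin d)) ℂ := Matrix.of fun a b =>
      if a.1 = b.1 then
        (1 / (d : ℂ)) * ((Real.sqrt (p a.2.2) : ℂ) * (Real.sqrt (p b.2.2) : ℂ)) *
          ω a.1 a.2.2 * conj (ω a.1 b.2.2) *
          ∑ r, φ a.2.2 (a.2.1, r) * conj (φ b.2.2 (b.2.1, r))
      else 0
    -- distribution of the phase measurement outcome X
    let q : Fin d → ℝ := fun x => (∑ bc : B × Fin d, ρXBC (x, bc) (x, bc)).re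
    condEntropyFst ρZR + condEntropyFst ρXBC = -∑ x, q x * Real.logb 2 (q x) ∧
    ((d = 2 ∧ ∀ z, p z = 1 / 2) →
      condEntropyFst ρZR + condEntropyFst ρXBC = 1) := by
  intro ω ρZR ρXBC q
  have hd0 : (d : ℂ) ≠ 0 := by exact_mod_cast hd.ne'
  have hsq : ∀ z, (Real.sqrt (p z) : ℂ) * (Real.sqrt (p z) : ℂ) = (p z : ℂ) := fun z => by
    rw [← Complex.ofReal_mul, Real.mul_self_sqrt (hp0 z)]
  have hωω : ∀ x z, ω x z * conj (ω x z) = 1 := fun x z => by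
    simp only [ω, fourier_phase_mul_conj]
    simp
  -- amplitudes of the pure state, as a matrix from `R` to `BC`
  let N : Matrix (B × Fin d) R ℂ := Matrix.of fun a r => (Real.sqrt (p a.2) : ℂ) * φ a.2 (a.1, r)
  -- the same amplitudes for the state dephased in the computational basis
  let L : Matrix (B × Fin d) (Fin d × R) ℂ := Matrix.of fun a b =>
    if a.2 = b.1 then N a b.2 else 0
  let P : Matrix (Fin d × (B × Fin d)) (Fin d × (B × Fin d)) ℂ :=
    diagonal fun a => ω a.1 a.2.2
  have hZR : ρZR = Lᵀ * Lᵀᴴ := by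
    ext a b
    simp only [ρZR, mul_apply, of_apply, transpose_apply, conjTranspose_apply, L,
      Fintype.sum_prod_type, N, ← hsq]
    split_ifs with h
    · simp [h, Finset.mul_sum]
      refine Finset.sum_congr rfl fun i _ => ?_
      ring
    · simp [h]
  have hR : ptraceLeft ρZR = Nᵀ * Nᵀᴴ := by
    ext a b
    simp only [ρZR, ptraceLeft, mul_apply, of_apply, transpose_apply, conjTranspose_apply,
      Fintype.sum_prod_type, N, ← hsq]
    rw [Finset.sum_comm]
    simp [Finset.mul_sum]
    refine Finset.sum_congr rfl fun i _ => Finset.sum_congr rfl fun j _ => ?_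
    ring
  have hXBC : ρXBC = P * ((diagonal fun _ : Fin d => (1 / d : ℂ)) ⊗ₖ (N * Nᴴ)) * Pᴴ := by
    ext a b
    simp only [P, diagonal_conjTranspose, mul_diagonal, diagonal_mul, kroneckerMap_apply,
      ρXBC, of_apply, diagonal_apply]
    split_ifs with h
    · simp [mul_apply, N, Finset.mul_sum, Finset.sum_mul, h]
      refine Finset.sum_congr rfl fun i _ => ?_
      ring
    · simp
  have hBC : ptraceLeft ρXBC = L * Lᴴ := by
    ext a b
    have h1 : ptraceLeft ρXBC a b = (∑ x, ω x a.2 * conj (ω x b.2)) * ((1 / (d : ℂ)) *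
        ((Real.sqrt (p a.2) : ℂ) * (Real.sqrt (p b.2) : ℂ)) *
          ∑ r, φ a.2 (a.1, r) * conj (φ b.2 (b.1, r))) := by
      simp only [ρXBC, ptraceLeft, of_apply, if_true]
      rw [Finset.sum_mul]
      refine Finset.sum_congr rfl fun i _ => ?_
      ring
    rw [h1, sum_fourier_phase_mul_conj hd]
    simp only [L, mul_apply, of_apply, conjTranspose_apply, Fintype.sum_prod_type, N]
    split_ifs with h
    · simp [h, Finset.mul_sum]
      refine Finset.sum_congr rfl fun i _ => ?_
      field_simp
    · simp [Ne.symm h]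
  have hblock : ∀ z, ∑ b, ∑ r, φ z (b, r) * conj (φ z (b, r)) = 1 := fun z => by
    rw [← Fintype.sum_prod_type (fun i => φ z i * conj (φ z i))]
    simp only [Complex.mul_conj]
    exact_mod_cast hφ z
  have htr : (N * Nᴴ).trace = 1 := by
    have : (∑ z, (p z : ℂ)) = 1 := by exact_mod_cast hp1
    rw [← this, trace, Fintype.sum_prod_type_right]
    refine Finset.sum_congr rfl fun z _ => ?_
    rw [← mul_one (p z : ℂ), ← hblock z, ← hsq]
    simp [mul_apply, N, Finset.mul_sum]
    refine Finset.sum_congr rfl fun i _ => Finset.sum_congr rfl fun j _ => ?_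
    ring
  have hq : ∀ x, q x = 1 / d := fun x => by
    have h1 : ∑ bc, ρXBC (x, bc) (x, bc) = 1 / d * (N * Nᴴ).trace := by
      rw [trace, Finset.mul_sum]
      refine Finset.sum_congr rfl fun bc _ => ?_
      rw [hXBC]
      simp only [P, diagonal_conjTranspose, mul_diagonal, diagonal_mul, kroneckerMap_apply,
        diagonal_apply_eq, diag_apply, Pi.star_apply]
      rw [← starRingEnd_apply]
      linear_combination (1 / d * (N * Nᴴ) bc bc) * hωω x bc.2
    simp only [q, h1, htr, mul_one]
    rw [← Complex.ofReal_natCast, ← Complex.ofReal_one, ← Complex.ofReal_div, Complex.ofReal_re]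
  have hP : Pᴴ * P = 1 := by
    simp only [P, diagonal_conjTranspose, diagonal_mul_diagonal, ← diagonal_one]
    congr 1
    ext a
    rw [mul_comm]
    exact hωω a.1 a.2.2
  have hN := isHermitian_mul_conjTranspose_self N
  have hHXBC : vnEntropy ρXBC = Real.logb 2 d + vnEntropy (N * Nᴴ) := by
    rw [hXBC, vnEntropy_unitary_conj _ hP, vnEntropy_maximallyMixed_kronecker hd hN htr]
    rw [IsHermitian, conjTranspose_kronecker, hN.eq, diagonal_conjTranspose]
    congr 2
    ext
    simp
  have hmain : condEntropyFst ρZR + condEntropyFst ρXBC = Real.logb 2 d := by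
    rw [condEntropyFst, condEntropyFst, hHXBC, hBC, hR, hZR, vnEntropy_mul_conjTranspose_comm N,
      vnEntropy_mul_conjTranspose_comm L]
    ring
  rw [hmain]
  refine ⟨?_, ?_⟩
  · have hd' : (d : ℝ) ≠ 0 := by exact_mod_cast hd.ne'
    simp only [hq, one_div, Real.logb_inv]
    simp [hd']
  · rintro ⟨rfl, -⟩
    simp
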